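/- The only positive integers n, k, ℓ with k ≥ 3 and n ≥ 3 satisfying (F^(k)_n)² = P_ℓ are (n, k, ℓ) = (6, 3, 7), i.e., 13² = 169 = P_7. -/

import Mathlib

/-- The Pell sequence: `P 0 = 0`, `P 1 = 1`, `P (ℓ+2) = 2 P (ℓ+1) + P ℓ`. -/
def pell : ℕ → ℤ
  | 0 => 0
  | 1 => 1
  | n + 2 => 2 * pell (n + 1) + pell n

/-- `kfib k j` is the `k`-generalized Fibonacci number `F⁽ᵏ⁾_n` with shifted index
`j = n + k - 2` (so `j = 0` corresponds to `n = 2 - k`).  Thus `kfib k j = 0` for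
`0 ≤ j ≤ k - 2` (these are `F⁽ᵏ⁾_{2-k} = ⋯ = F⁽ᵏ⁾_0 = 0`), `kfib k (k - 1) = 1`
(this is `F⁽ᵏ⁾_1 = 1`), and every later term is the sum of the preceding `k` terms
(junk value `0` if `k < 2`). -/
def kfib (k : ℕ) : ℕ → ℤ
  | j =>
    if k < 2 then 0
    else if j < k - 1 then 0
    else if j = k - 1 then 1
    else ∑ i ∈ Finset.range k, kfib k (j - 1 - i)
decreasing_by omega

section Pade

open Finset

theorem factorial_dvd_prod_add (x : ℤ) (m : ℕ) :
    (m.factorial : ℤ) ∣ ∏ i ∈ range m, (x + i) := by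
  have h : ∏ i ∈ range m, (x + i) = (ascPochhammer ℤ m).eval x := by
    induction m with
    | zero => simp
    | succ m ih => rw [prod_range_succ, ih, ascPochhammer_succ_eval]
  rw [h, ← Polynomial.ascPochhammer_smeval_eq_eval,
    ← Ring.factorial_nsmul_multichoose_eq_ascPochhammer, nsmul_eq_mul]
  exact dvd_mul_right _ _

theorem factorial_dvd_two_pow_mul_prod (b : ℤ) (m : ℕ) :
    (m.factorial : ℤ) ∣ 2 ^ m * ∏ i ∈ range m, (b + 4 * i) := by
  obtain ⟨s, o, ho, hso⟩ := Nat.exists_eq_two_pow_mul_odd m.factorial_ne_zero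
  have hs : s ≤ m := by
    have h1 := sub_one_mul_padicValNat_factorial (p := 2) m
    have h2 : padicValNat 2 m.factorial = s := by
      rw [hso, padicValNat.mul (by positivity) (by rintro rfl; simp at ho),
        padicValNat.prime_pow, padicValNat.eq_zero_of_not_dvd ho.not_two_dvd_nat, add_zero]
    omega
  have hcop : IsCoprime (4 : ℤ) (o : ℤ) := by
    have : Nat.Coprime 4 o := by
      have := (Nat.coprime_two_left.mpr ho).pow_left 2
      simpa using this
    exact_mod_cast Nat.isCoprime_iff_coprime.mpr this
  have hodd : (o : ℤ) ∣ ∏ i ∈ range m, (b + 4 * i) := by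
    obtain ⟨c, d, hcd⟩ := hcop
    have h1 : (∏ i ∈ range m, (b + 4 * i) : ℤ) ≡ ∏ i ∈ range m, (4 * (b * c + i)) [ZMOD o] := by
      refine Int.ModEq.prod fun i _ => ?_
      refine (Int.modEq_iff_dvd.mpr ⟨-(b * d), ?_⟩)
      linear_combination b * hcd
    rw [h1.dvd_iff, prod_mul_distrib]
    refine Dvd.dvd.mul_left (Dvd.dvd.trans ?_ (factorial_dvd_prod_add (b * c) m)) _
    exact Dvd.intro_left (2 ^ s : ℤ) (by rw [hso]; push_cast; rfl)
  rw [hso]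
  push_cast
  exact mul_dvd_mul (pow_dvd_pow 2 hs) hodd

/-- The coefficients `1 / (m! (1 + a) (2 + a) ⋯ (m + a))`. -/
noncomputable def padeCoeff (a : ℝ) (m : ℕ) : ℝ :=
  1 / (m.factorial * ∏ i ∈ range m, (i + 1 + a))

/-- The product `∏ (i² - 1/16)` over `1 ≤ i ≤ r`. -/
noncomputable def padeScale (r : ℕ) : ℝ :=
  ∏ i ∈ range r, (((i : ℝ) + 1) ^ 2 - 1 / 16)

/-- The coefficients of the diagonal Padé approximants of `x ↦ x ^ (1 / 4)` at `1`. -/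
noncomputable def padeTerm (x : ℕ × ℕ) : ℝ :=
  padeCoeff (-1 / 4) x.1 * padeCoeff (1 / 4) x.2

theorem padeCoeff_succ {a : ℝ} (ha : -1 < a) (m : ℕ) :
    ((m : ℝ) + 1) * (m + 1 + a) * padeCoeff a (m + 1) = padeCoeff a m := by
  have h : ∀ i : ℕ, (i : ℝ) + 1 + a ≠ 0 := fun i => by
    have : (0 : ℝ) ≤ i := i.cast_nonneg
    linarith
  have h' : ∏ i ∈ range m, ((i : ℝ) + 1 + a) ≠ 0 := prod_ne_zero_iff.mpr fun i _ => h i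
  have hm := h m
  have : (m : ℝ) + 1 ≠ 0 := by positivity
  have := m.factorial_ne_zero
  rw [padeCoeff, padeCoeff, prod_range_succ, Nat.factorial_succ]
  push_cast
  field_simp

theorem padeTerm_succ_left (m j : ℕ) :
    ((m : ℝ) + 1) * (m + 1 - 1 / 4) * padeTerm (m + 1, j) = padeTerm (m, j) := by
  rw [padeTerm, padeTerm, ← padeCoeff_succ (by norm_num : (-1 : ℝ) < -1 / 4) m]
  ring

theorem padeTerm_succ_right (m j : ℕ) :
    ((j : ℝ) + 1) * (j + 1 + 1 / 4) * padeTerm (m, j + 1) = padeTerm (m, j) := by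
  rw [padeTerm, padeTerm, ← padeCoeff_succ (by norm_num : (-1 : ℝ) < 1 / 4) j]
  ring

theorem sum_antidiagonal_shift_left {E : Type*} [AddCommMonoid E] {F G : ℕ × ℕ → E} (n : ℕ)
    (h0 : ∀ j, F (0, j) = 0) (h : ∀ m j, F (m + 1, j) = G (m, j)) :
    ∑ x ∈ antidiagonal n, G x = ∑ x ∈ antidiagonal (n + 1), F x := by
  rw [Nat.sum_antidiagonal_succ, h0, zero_add]
  exact sum_congr rfl fun x _ => (h _ _).symm

theorem sum_antidiagonal_shift_right {E : Type*} [AddCommMonoid E] {F G : ℕ × ℕ → E} (n : ℕ)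
    (h0 : ∀ m, F (m, 0) = 0) (h : ∀ m j, F (m, j + 1) = G (m, j)) :
    ∑ x ∈ antidiagonal n, G x = ∑ x ∈ antidiagonal (n + 1), F x := by
  rw [Nat.sum_antidiagonal_succ', h0, zero_add]
  exact sum_congr rfl fun x _ => (h _ _).symm

/-- The Padé numerator, homogenised in `u` and `v`. -/
noncomputable def padeForm (u v : ℂ) (r : ℕ) : ℂ :=
  padeScale r * ∑ x ∈ antidiagonal r, padeTerm x * (u ^ x.1 * v ^ x.2)

theorem padeForm_rec (u v : ℂ) (r : ℕ) :
    ((r : ℂ) + 1) * (r + 2) * padeForm u v (r + 2) =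
      (r + 1) * (2 * r + 3) * (u + v) * padeForm u v (r + 1)
        - ((r + 1) ^ 2 - 1 / 16) * (u - v) ^ 2 * padeForm u v r := by
  have hl : ∀ m j : ℕ, ((m : ℂ) + 1) * (m + 1 - 1 / 4) * (padeTerm (m + 1, j) : ℂ)
      = padeTerm (m, j) := fun m j => by
    have := congrArg Complex.ofReal (padeTerm_succ_left m j)
    push_cast at this
    exact this
  have hr : ∀ m j : ℕ, ((j : ℂ) + 1) * (j + 1 + 1 / 4) * (padeTerm (m, j + 1) : ℂ)
      = padeTerm (m, j) := fun m j => by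
    have := congrArg Complex.ofReal (padeTerm_succ_right m j)
    push_cast at this
    exact this
  set S : ℕ → ℂ := fun r => ∑ x ∈ antidiagonal r, padeTerm x * (u ^ x.1 * v ^ x.2) with hS
  have e1 : ∀ n, u * S n = ∑ x ∈ antidiagonal (n + 1),
      (x.1 : ℂ) * (x.1 - 1 / 4) * (padeTerm x * (u ^ x.1 * v ^ x.2)) := fun n => by
    rw [hS, mul_sum]
    refine sum_antidiagonal_shift_left n (by simp) fun m j => ?_
    simp only [← hl m j]
    push_cast
    ring
  have e2 : ∀ n, v * S n = ∑ x ∈ antidiagonal (n + 1),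
      (x.2 : ℂ) * (x.2 + 1 / 4) * (padeTerm x * (u ^ x.1 * v ^ x.2)) := fun n => by
    rw [hS, mul_sum]
    refine sum_antidiagonal_shift_right n (by simp) fun m j => ?_
    simp only [← hr m j]
    push_cast
    ring
  have e3 : u * (u * S r) = ∑ x ∈ antidiagonal (r + 2), (x.1 : ℂ) * (x.1 - 1 / 4) *
      ((x.1 - 1) * (x.1 - 1 - 1 / 4)) * (padeTerm x * (u ^ x.1 * v ^ x.2)) := by
    rw [e1, mul_sum]
    refine sum_antidiagonal_shift_left (r + 1) (by simp) fun m j => ?_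
    simp only [← hl m j]
    push_cast
    ring
  have e4 : v * (u * S r) = ∑ x ∈ antidiagonal (r + 2), (x.1 : ℂ) * (x.1 - 1 / 4) *
      (x.2 * (x.2 + 1 / 4)) * (padeTerm x * (u ^ x.1 * v ^ x.2)) := by
    rw [e1, mul_sum]
    refine sum_antidiagonal_shift_right (r + 1) (by simp) fun m j => ?_
    simp only [← hr m j]
    push_cast
    ring
  have e5 : v * (v * S r) = ∑ x ∈ antidiagonal (r + 2), (x.2 : ℂ) * (x.2 + 1 / 4) *
      ((x.2 - 1) * (x.2 - 1 + 1 / 4)) * (padeTerm x * (u ^ x.1 * v ^ x.2)) := by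
    rw [e2, mul_sum]
    refine sum_antidiagonal_shift_right (r + 1) (by simp) fun m j => ?_
    simp only [← hr m j]
    push_cast
    ring
  have key : ((r : ℂ) + 1) * (r + 2) * ((r + 2) ^ 2 - 1 / 16) * S (r + 2) =
      (r + 1) * (2 * r + 3) * (u * S (r + 1) + v * S (r + 1))
        - (u * (u * S r) - 2 * (v * (u * S r)) + v * (v * S r)) := by
    rw [e3, e4, e5, e1, e2, hS]
    simp only [mul_sum, ← sum_add_distrib, ← sum_sub_distrib]
    refine sum_congr rfl fun x hx => ?_
    have hx' : (x.1 : ℂ) + x.2 = r + 2 := by exact_mod_cast mem_antidiagonal.mp hx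
    have hr2 : (r : ℂ) = x.1 + x.2 - 2 := by linear_combination -hx'
    rw [hr2]
    ring
  have w1 : padeScale (r + 1) = padeScale r * (((r : ℝ) + 1) ^ 2 - 1 / 16) := prod_range_succ _ _
  have w2 : padeScale (r + 2) = padeScale (r + 1) * (((r : ℝ) + 2) ^ 2 - 1 / 16) := by
    rw [padeScale, prod_range_succ]
    push_cast
    rw [padeScale]
    ring
  have : ∀ n, padeForm u v n = padeScale n * S n := fun n => rfl
  rw [this, this, this, w2, w1]
  push_cast
  linear_combination (padeScale r : ℂ) * (((r : ℂ) + 1) ^ 2 - 1 / 16) * key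

/-- The error function of the Padé approximation on the unit circle. -/
noncomputable def padeErr (r : ℕ) (b : ℝ) : ℝ :=
  padeScale r * ∑ x ∈ antidiagonal r, padeTerm x * Real.sin ((x.1 - x.2 - 1 / 4) * b)

theorem hasDerivAt_padeErr (r : ℕ) (b : ℝ) :
    HasDerivAt (padeErr (r + 1))
      (-2 * ((((r : ℝ) + 1) ^ 2 - 1 / 16) / (r + 1)) * (Real.sin b * padeErr r b)) b := by
  have h : HasDerivAt (padeErr (r + 1)) (padeScale (r + 1) * ∑ x ∈ antidiagonal (r + 1),
      padeTerm x * (Real.cos ((x.1 - x.2 - 1 / 4) * b) * (x.1 - x.2 - 1 / 4))) b := by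
    refine HasDerivAt.const_mul _ (HasDerivAt.fun_sum fun x _ => HasDerivAt.const_mul _ ?_)
    exact (hasDerivAt_const_mul _).sin
  convert h using 1
  have e1 : ∑ x ∈ antidiagonal r, padeTerm x * Real.cos ((x.1 - x.2 - 1 / 4 + 1) * b) =
      ∑ x ∈ antidiagonal (r + 1), (x.1 : ℝ) * (x.1 - 1 / 4) *
        (padeTerm x * Real.cos ((x.1 - x.2 - 1 / 4) * b)) := by
    refine sum_antidiagonal_shift_left r (by simp) fun m j => ?_
    simp only [← padeTerm_succ_left m j]
    push_cast
    ring_nf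
  have e2 : ∑ x ∈ antidiagonal r, padeTerm x * Real.cos ((x.1 - x.2 - 1 / 4 - 1) * b) =
      ∑ x ∈ antidiagonal (r + 1), (x.2 : ℝ) * (x.2 + 1 / 4) *
        (padeTerm x * Real.cos ((x.1 - x.2 - 1 / 4) * b)) := by
    refine sum_antidiagonal_shift_right r (by simp) fun m j => ?_
    simp only [← padeTerm_succ_right m j]
    push_cast
    ring_nf
  have e3 : -2 * (Real.sin b * ∑ x ∈ antidiagonal r,
      padeTerm x * Real.sin ((x.1 - x.2 - 1 / 4) * b)) =
      ∑ x ∈ antidiagonal r, padeTerm x * Real.cos ((x.1 - x.2 - 1 / 4 + 1) * b) -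
        ∑ x ∈ antidiagonal r, padeTerm x * Real.cos ((x.1 - x.2 - 1 / 4 - 1) * b) := by
    rw [← sum_sub_distrib, mul_sum, mul_sum]
    refine sum_congr rfl fun x _ => ?_
    rw [add_mul, sub_mul _ 1, Real.cos_add, Real.cos_sub, one_mul]
    ring
  have e4 : ((r : ℝ) + 1) * ∑ x ∈ antidiagonal (r + 1),
      padeTerm x * (Real.cos ((x.1 - x.2 - 1 / 4) * b) * (x.1 - x.2 - 1 / 4)) =
      -2 * (Real.sin b * ∑ x ∈ antidiagonal r,
        padeTerm x * Real.sin ((x.1 - x.2 - 1 / 4) * b)) := by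
    rw [e3, e1, e2, ← sum_sub_distrib, mul_sum]
    refine sum_congr rfl fun x hx => ?_
    have hx' : (x.1 : ℝ) + x.2 = r + 1 := by exact_mod_cast mem_antidiagonal.mp hx
    rw [← hx']
    ring
  have w1 : padeScale (r + 1) = padeScale r * (((r : ℝ) + 1) ^ 2 - 1 / 16) := prod_range_succ _ _
  have hr : (r : ℝ) + 1 ≠ 0 := by positivity
  rw [w1, padeErr]
  generalize ∑ x ∈ antidiagonal (r + 1), padeTerm x *
    (Real.cos ((x.1 - x.2 - 1 / 4) * b) * (x.1 - x.2 - 1 / 4)) = A at e4 ⊢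
  generalize ∑ x ∈ antidiagonal r, padeTerm x * Real.sin ((x.1 - x.2 - 1 / 4) * b) = B at e4 ⊢
  field_simp
  linear_combination -(padeScale r) * (16 * ((r : ℝ) + 1) ^ 2 - 1) * e4

theorem abs_padeErr_le (r : ℕ) {b : ℝ} (hb : 0 ≤ b) : |padeErr r b| ≤ b ^ (2 * r + 1) / 4 := by
  induction r generalizing b with
  | zero =>
    simp only [padeErr, padeScale, padeTerm, padeCoeff, Nat.antidiagonal_zero, sum_singleton]
    norm_num
    have := Real.abs_sin_le_abs (x := 1 / 4 * b)
    rw [abs_of_nonneg (by positivity : 0 ≤ 1 / 4 * b)] at this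
    linarith
  | succ r ih =>
    have hd : ∀ x : ℝ, HasDerivAt (fun x : ℝ => x ^ (2 * (r + 1) + 1) / 4)
        ((2 * r + 3) * x ^ (2 * r + 2) / 4) x := fun x => by
      refine ((hasDerivAt_pow (2 * (r + 1) + 1) x).div_const 4).congr_deriv ?_
      rw [show 2 * (r + 1) + 1 - 1 = 2 * r + 2 by omega]
      push_cast
      ring
    refine image_norm_le_of_norm_deriv_right_le_deriv_boundary
      (f := padeErr (r + 1)) (a := 0) (b := b)
      (fun x _ => (hasDerivAt_padeErr r x).continuousAt.continuousWithinAt)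
      (fun x _ => (hasDerivAt_padeErr r x).hasDerivWithinAt) (by simp [padeErr]) hd ?_
      ⟨hb, le_rfl⟩
    intro x hx
    have h1 := ih hx.1
    have h2 : |Real.sin x| ≤ x := by simpa [abs_of_nonneg hx.1] using Real.abs_sin_le_abs (x := x)
    have h3 : |Real.sin x * padeErr r x| ≤ x * (x ^ (2 * r + 1) / 4) := by
      rw [abs_mul]
      exact mul_le_mul h2 h1 (abs_nonneg _) hx.1
    have hr : (0 : ℝ) ≤ r := r.cast_nonneg
    have h4 : |-2 * ((((r : ℝ) + 1) ^ 2 - 1 / 16) / ((r : ℝ) + 1))| ≤ 2 * (r : ℝ) + 3 := by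
      rw [abs_mul, abs_of_nonneg (div_nonneg (by nlinarith) (by positivity) :
        0 ≤ (((r : ℝ) + 1) ^ 2 - 1 / 16) / ((r : ℝ) + 1))]
      have : (((r : ℝ) + 1) ^ 2 - 1 / 16) / ((r : ℝ) + 1) ≤ r + 1 := by
        rw [div_le_iff₀ (by positivity)]
        nlinarith
      norm_num
      linarith
    rw [Real.norm_eq_abs, abs_mul]
    calc _ ≤ (2 * (r : ℝ) + 3) * (x * (x ^ (2 * r + 1) / 4)) :=
          mul_le_mul h4 h3 (abs_nonneg _) (by positivity)
      _ = _ := by ring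

theorem exists_int_eight_pow_mul_prod (b : ℤ) (n : ℕ) :
    ∃ z : ℤ, (8 : ℝ) ^ n * ∏ i ∈ range n, ((b : ℝ) / 4 + i) = n.factorial * z := by
  obtain ⟨z, hz⟩ := factorial_dvd_two_pow_mul_prod b n
  refine ⟨z, ?_⟩
  have h1 : (2 : ℝ) ^ n * ∏ i ∈ range n, ((b : ℝ) + 4 * i) = n.factorial * z := by
    exact_mod_cast hz
  rw [← h1, show (8 : ℝ) = 2 * 4 by norm_num, mul_pow, mul_assoc]
  congr 1
  rw [show (4 : ℝ) ^ n = ∏ _i ∈ range n, 4 by simp, ← prod_mul_distrib]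
  exact prod_congr rfl fun i _ => by ring

theorem exists_int_padeScale_mul_padeTerm (m j : ℕ) :
    ∃ z : ℤ, (8 : ℝ) ^ (m + j) * (padeScale (m + j) * padeTerm (m, j)) = z := by
  obtain ⟨y, hy⟩ := exists_int_eight_pow_mul_prod (4 * m + 3) j
  obtain ⟨z, hz⟩ := exists_int_eight_pow_mul_prod (4 * j + 5) m
  refine ⟨y * z, ?_⟩
  have hs : padeScale (m + j) =
      (∏ i ∈ range (m + j), ((i : ℝ) + 1 + -1 / 4)) * ∏ i ∈ range (j + m), ((i : ℝ) + 1 + 1 / 4) := by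
    rw [padeScale, add_comm j m, ← prod_mul_distrib]
    exact prod_congr rfl fun i _ => by ring
  have hne : ∀ a : ℝ, -1 < a → ∀ n, ∏ i ∈ range n, ((i : ℝ) + 1 + a) ≠ 0 := fun a ha n =>
    prod_ne_zero_iff.mpr fun i _ => by
      have : (0 : ℝ) ≤ i := i.cast_nonneg
      linarith
  have h1 := hne (-1 / 4) (by norm_num) m
  have h2 := hne (1 / 4) (by norm_num) j
  have hy' : ∏ i ∈ range j, (((m + i : ℕ) : ℝ) + 1 + -1 / 4) =
      ∏ i ∈ range j, (((4 * m + 3 : ℤ) : ℝ) / 4 + i) :=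
    prod_congr rfl fun i _ => by push_cast; ring
  have hz' : ∏ i ∈ range m, (((j + i : ℕ) : ℝ) + 1 + 1 / 4) =
      ∏ i ∈ range m, (((4 * j + 5 : ℤ) : ℝ) / 4 + i) :=
    prod_congr rfl fun i _ => by push_cast; ring
  have f1 := m.factorial_ne_zero
  have f2 := j.factorial_ne_zero
  rw [hs, prod_range_add, prod_range_add, padeTerm, padeCoeff, padeCoeff, hy', hz']
  generalize ∏ i ∈ range j, (((4 * m + 3 : ℤ) : ℝ) / 4 + i) = Y at hy
  generalize ∏ i ∈ range m, (((4 * j + 5 : ℤ) : ℝ) / 4 + i) = Z at hz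
  generalize ∏ i ∈ range m, ((i : ℝ) + 1 + -1 / 4) = C at *
  generalize ∏ i ∈ range j, ((i : ℝ) + 1 + 1 / 4) = D at *
  push_cast
  field_simp
  rw [pow_add]
  linear_combination (8 : ℝ) ^ m * Z * hy + j.factorial * y * hz

theorem eight_pow_mul_padeForm_mem {u v : ℂ} (hu : u ∈ GaussianInt.toComplex.range)
    (hv : v ∈ GaussianInt.toComplex.range) (r : ℕ) :
    8 ^ r * padeForm u v r ∈ GaussianInt.toComplex.range := by
  rw [padeForm, mul_sum, mul_sum]
  refine sum_mem fun x hx => ?_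
  obtain ⟨z, hz⟩ := exists_int_padeScale_mul_padeTerm x.1 x.2
  rw [mem_antidiagonal.mp hx] at hz
  have hz' : (8 : ℂ) ^ r * (padeScale r * padeTerm x) = z := by exact_mod_cast hz
  rw [← mul_assoc (padeScale r : ℂ), ← mul_assoc, hz']
  exact mul_mem (intCast_mem _ z) (mul_mem (pow_mem hu _) (pow_mem hv _))

/-- The denominators of Padé approximants of `((239 + i) / (239 - i)) ^ (1 / 4)`. -/
noncomputable def padeValue (r : ℕ) : ℂ :=
  padeForm (239 + Complex.I) (239 - Complex.I) r

theorem padeValue_zero : padeValue 0 = 1 := by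
  simp [padeValue, padeForm, padeScale, padeTerm, padeCoeff]

theorem padeValue_one : padeValue 1 = 478 + 1 / 2 * Complex.I := by
  simp [padeValue, padeForm, padeScale, padeTerm, padeCoeff, Nat.antidiagonal_succ]
  ring

theorem padeValue_rec (r : ℕ) :
    (((r : ℝ) + 1) * (r + 2) : ℝ) * padeValue (r + 2) =
      (((r : ℝ) + 1) * (2 * r + 3) * 478 : ℝ) * padeValue (r + 1)
        + (4 * (((r : ℝ) + 1) ^ 2 - 1 / 16) : ℝ) * padeValue r := by
  have h := padeForm_rec (239 + Complex.I) (239 - Complex.I) r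
  rw [padeValue, padeValue, padeValue]
  push_cast
  rw [h]
  linear_combination -4 * (((r : ℂ) + 1) ^ 2 - 1 / 16) *
    padeForm (239 + Complex.I) (239 - Complex.I) r * Complex.I_sq

theorem norm_padeValue_le (r : ℕ) : ‖padeValue r‖ ≤ 957 ^ r := by
  induction r using Nat.twoStepInduction with
  | zero => simp [padeValue_zero]
  | one =>
    rw [padeValue_one]
    refine (norm_add_le _ _).trans ?_
    norm_num
  | more r h0 h1 =>
    have hr : (0 : ℝ) ≤ r := r.cast_nonneg
    have h := congrArg norm (padeValue_rec r)
    rw [norm_mul, Complex.norm_real, Real.norm_of_nonneg (by positivity)] at h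
    have h2 : ‖((((r : ℝ) + 1) * (2 * r + 3) * 478 : ℝ) : ℂ) * padeValue (r + 1)‖ ≤
        (((r : ℝ) + 1) * (2 * r + 3) * 478) * 957 ^ (r + 1) := by
      rw [norm_mul, Complex.norm_real, Real.norm_of_nonneg (by positivity)]
      gcongr
    have h3 : ‖((4 * (((r : ℝ) + 1) ^ 2 - 1 / 16) : ℝ) : ℂ) * padeValue r‖ ≤
        (4 * (((r : ℝ) + 1) ^ 2 - 1 / 16)) * 957 ^ r := by
      have : 0 ≤ (4 * (((r : ℝ) + 1) ^ 2 - 1 / 16)) := by nlinarith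
      rw [norm_mul, Complex.norm_real, Real.norm_of_nonneg this]
      gcongr
    have h4 := (h.le.trans (norm_add_le _ _)).trans (add_le_add h2 h3)
    have h5 : ((r : ℝ) + 1) * (r + 2) * ‖padeValue (r + 2)‖ ≤
        ((r : ℝ) + 1) * (r + 2) * 957 ^ (r + 2) := by
      refine h4.trans ?_
      have h6 : (0 : ℝ) < 957 ^ r := by positivity
      have h7 : ((r : ℝ) + 1) * (2 * r + 3) * 478 * 957 + 4 * (((r : ℝ) + 1) ^ 2 - 1 / 16) ≤
          ((r : ℝ) + 1) * (r + 2) * 957 ^ 2 := by nlinarith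
      calc _ = (((r : ℝ) + 1) * (2 * r + 3) * 478 * 957 + 4 * (((r : ℝ) + 1) ^ 2 - 1 / 16)) *
            957 ^ r := by ring
        _ ≤ ((r : ℝ) + 1) * (r + 2) * 957 ^ 2 * 957 ^ r := by gcongr
        _ = _ := by ring
    exact le_of_mul_le_mul_left h5 (by positivity)

theorem im_conj_padeValue_mul_succ_ne_zero (r : ℕ) :
    (padeValue r).re * (padeValue (r + 1)).im - (padeValue r).im * (padeValue (r + 1)).re ≠ 0 := by
  induction r with
  | zero => simp [padeValue_zero, padeValue_one]
  | succ r ih =>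
    have hr : (0 : ℝ) ≤ r := r.cast_nonneg
    have hre := congrArg Complex.re (padeValue_rec r)
    have him := congrArg Complex.im (padeValue_rec r)
    simp only [Complex.add_re, Complex.add_im, Complex.re_ofReal_mul, Complex.im_ofReal_mul]
      at hre him
    intro h
    have h1 : 0 < 4 * (((r : ℝ) + 1) ^ 2 - 1 / 16) := by nlinarith
    refine mul_ne_zero h1.ne' ih ?_
    linear_combination -((r : ℝ) + 1) * (r + 2) * h + (padeValue (r + 1)).re * him -
      (padeValue (r + 1)).im * hre

theorem im_exp_mul_padeValue (r : ℕ) :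
    (Complex.exp (-((239 + Complex.I).arg / 4 : ℝ) * Complex.I) * padeValue r).im =
      ‖239 + Complex.I‖ ^ r * padeErr r (239 + Complex.I).arg := by
  set b := (239 + Complex.I).arg with hb
  set R := ‖239 + Complex.I‖ with hR
  have hu : (239 + Complex.I) = R * Complex.exp (b * Complex.I) :=
    (Complex.norm_mul_exp_arg_mul_I _).symm
  have hv : (239 - Complex.I) = R * Complex.exp (-b * Complex.I) := by
    have := congrArg (starRingEnd ℂ) hu
    simpa [← Complex.exp_conj, sub_eq_add_neg, map_ofNat (starRingEnd ℂ) 239] using this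
  have : Complex.exp (-(b / 4 : ℝ) * Complex.I) * padeValue r =
      (R ^ r * padeScale r : ℝ) * ∑ x ∈ antidiagonal r,
        padeTerm x * Complex.exp (((x.1 - x.2 - 1 / 4) * b : ℝ) * Complex.I) := by
    rw [padeValue, padeForm, hu, hv, mul_sum, mul_sum, mul_sum]
    refine sum_congr rfl fun x hx => ?_
    rw [← mem_antidiagonal.mp hx, mul_pow, mul_pow, ← Complex.exp_nat_mul, ← Complex.exp_nat_mul,
      show (((x.1 - x.2 - 1 / 4) * b : ℝ) : ℂ) * Complex.I = -((b / 4 : ℝ) : ℂ) * Complex.I +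
        (x.1 * (b * Complex.I) + x.2 * (-b * Complex.I)) by push_cast; ring,
      Complex.exp_add, Complex.exp_add]
    push_cast
    ring
  rw [this, Complex.im_ofReal_mul, Complex.im_sum, padeErr, mul_assoc]
  congr 2
  refine sum_congr rfl fun x _ => ?_
  rw [Complex.im_ofReal_mul, Complex.exp_ofReal_mul_I_im]

theorem norm_mul_arg_sq_le :
    0 ≤ (239 + Complex.I).arg ∧ (239 + Complex.I).arg ≤ 1 ∧ ‖239 + Complex.I‖ ≤ 240 ∧
      ‖239 + Complex.I‖ * (239 + Complex.I).arg ^ 2 ≤ 1 / 232 := by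
  have h0 : 0 ≤ (239 + Complex.I).arg := by simp [Complex.arg_nonneg_iff]
  have h1 : (239 + Complex.I).arg < Real.pi / 2 :=
    (abs_lt.mp (Complex.abs_arg_lt_pi_div_two_iff.mpr (Or.inl (by simp)))).2
  have h2 : (239 + Complex.I).arg ≤ 1 / 239 := by
    have := Real.le_tan h0 h1
    rw [Complex.tan_arg] at this
    simpa using this
  have h3 : ‖239 + Complex.I‖ ≤ 240 := by
    refine (norm_add_le _ _).trans ?_
    norm_num
  refine ⟨h0, by linarith, h3, ?_⟩
  calc _ ≤ (240 : ℝ) * (1 / 239) ^ 2 := by gcongr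
    _ ≤ _ := by norm_num

theorem fourth_power_near_real_axis {s t M N R : ℝ} (hM : 0 < M) (hN : |N| ≤ 2) (hR0 : 0 < R)
    (hR : R ≤ 240) (hre : s ^ 4 - 6 * s ^ 2 * t ^ 2 + t ^ 4 = M * R)
    (him : 4 * s * t * (s ^ 2 - t ^ 2) = N * R) (hts : |t| ≤ s) :
    M * R ≤ s ^ 4 ∧ |t| * s ^ 3 ≤ 240 := by
  have hs : 0 ≤ s := (abs_nonneg t).trans hts
  have h1 : t ^ 2 ≤ s ^ 2 := sq_le_sq' (by linarith [neg_abs_le t]) ((le_abs_self t).trans hts)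
  have hMR : 0 < M * R := mul_pos hM hR0
  have h2 : s ^ 2 ≤ 2 * (s ^ 2 - t ^ 2) := by
    by_contra! h
    nlinarith [sq_nonneg t, sq_nonneg s]
  refine ⟨by nlinarith [sq_nonneg t, sq_nonneg s], ?_⟩
  have h3 : 4 * s * |t| * (s ^ 2 - t ^ 2) ≤ 480 := by
    have := congrArg abs him
    rw [abs_mul, abs_mul, abs_mul, abs_mul, abs_of_nonneg hs, abs_of_pos hR0,
      abs_of_nonneg (sub_nonneg.mpr h1), abs_of_pos (by norm_num : (0 : ℝ) < 4)] at this
    rw [this]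
    nlinarith [abs_nonneg N]
  have h4 : 0 ≤ s * |t| := by positivity
  nlinarith

theorem exists_pow_near_of_large {s t : ℝ} (hs : 10 ^ 37 ≤ s) (ht : |t| * s ^ 3 ≤ 240) :
    ∃ r : ℕ, (1 / 29 : ℝ) ^ r * s + 7656 ^ (r + 1) * |t| < 1 := by
  obtain ⟨n, hn, hn'⟩ := exists_nat_pow_near (by linarith : 1 ≤ 4 * s) (by norm_num : (1 : ℝ) < 29)
  have hs0 : 0 < s := by linarith
  refine ⟨n + 1, ?_⟩
  have h1 : (1 / 29 : ℝ) ^ (n + 1) * s < 1 / 4 := by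
    rw [one_div_pow, one_div_mul_eq_div, div_lt_iff₀ (by positivity)]
    linarith
  have h2 : (7656 : ℝ) ^ (n + 1 + 1) * |t| ≤ 1 / 2 := by
    by_contra! h
    have h3 : (1 / 2 * s ^ 3) ^ 3 < (7656 ^ (n + 1 + 1) * 240) ^ 3 := by
      refine pow_lt_pow_left₀ ?_ (by positivity) (by norm_num)
      calc 1 / 2 * s ^ 3 < 7656 ^ (n + 1 + 1) * |t| * s ^ 3 := by gcongr
        _ ≤ 7656 ^ (n + 1 + 1) * 240 := by rw [mul_assoc]; gcongr
    have h4 : (7656 ^ (n + 1 + 1) * 240 : ℝ) ^ 3 ≤ (29 ^ n) ^ 8 * (7656 ^ 2 * 240) ^ 3 := by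
      have : ((7656 : ℝ) ^ 3) ^ n ≤ (29 ^ 8) ^ n := by gcongr; norm_num
      have e : ∀ x : ℝ, (x ^ (n + 1 + 1) * 240) ^ 3 = (x ^ 3) ^ n * (x ^ 2 * 240) ^ 3 :=
        fun x => by ring
      rw [e, pow_right_comm (29 : ℝ)]
      gcongr
    have h5 : ((29 : ℝ) ^ n) ^ 8 ≤ (4 * s) ^ 8 := by gcongr
    have h6 : (1 / 8 * s) * s ^ 8 < (4 ^ 8 * (7656 ^ 2 * 240) ^ 3) * s ^ 8 := by
      calc (1 / 8 * s) * s ^ 8 = (1 / 2 * s ^ 3) ^ 3 := by ring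
        _ < (4 * s) ^ 8 * (7656 ^ 2 * 240) ^ 3 := by
          refine (h3.trans_le h4).trans_le ?_
          gcongr
        _ = _ := by ring
    have h7 := lt_of_mul_lt_mul_right h6 (by positivity)
    norm_num at h7
    linarith
  linarith

theorem fourth_power_not_large_of_le {p : GaussianInt} {M N : ℝ} (hM : 10 ^ 150 ≤ M)
    (hN : |N| ≤ 2) (hp : (p : ℂ) ^ 4 = (M + N * Complex.I) * (239 + Complex.I))
    (hts : |(Complex.exp (-((239 + Complex.I).arg / 4 : ℝ) * Complex.I) * p).im| ≤
      (Complex.exp (-((239 + Complex.I).arg / 4 : ℝ) * Complex.I) * p).re) : False := by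
  obtain ⟨hb0, hb1, hR, hRb⟩ := norm_mul_arg_sq_le
  have hbound := im_exp_mul_padeValue
  have hR239 : 239 ≤ ‖239 + Complex.I‖ := by
    simpa using Complex.re_le_norm (239 + Complex.I)
  have hu : (239 + Complex.I) =
      ‖239 + Complex.I‖ * Complex.exp ((239 + Complex.I).arg * Complex.I) :=
    (Complex.norm_mul_exp_arg_mul_I _).symm
  set b := (239 + Complex.I).arg with hb
  set R := ‖239 + Complex.I‖ with hR'
  set e := Complex.exp (-(b / 4 : ℝ) * Complex.I) with he
  have he4 : e ^ 4 * Complex.exp (b * Complex.I) = 1 := by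
    rw [he, ← Complex.exp_nat_mul, ← Complex.exp_add]
    convert Complex.exp_zero using 2
    push_cast
    ring
  have hen : ‖e‖ = 1 := by
    rw [he, ← Complex.ofReal_neg]
    exact Complex.norm_exp_ofReal_mul_I _
  set s := (e * p).re with hs
  set t := (e * p).im with ht
  have hst : (e * p : ℂ) = s + t * Complex.I := (Complex.re_add_im _).symm
  have h4 : ((s : ℂ) + t * Complex.I) ^ 4 = ((M * R : ℝ) : ℂ) + ((N * R : ℝ) : ℂ) * Complex.I := by
    rw [← hst, mul_pow, hp]
    nth_rw 1 [hu]
    push_cast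
    linear_combination (M + N * Complex.I) * R * he4
  have h4' : ((s : ℂ) + t * Complex.I) ^ 4 = ((s ^ 4 - 6 * s ^ 2 * t ^ 2 + t ^ 4 : ℝ) : ℂ) +
      ((4 * s * t * (s ^ 2 - t ^ 2) : ℝ) : ℂ) * Complex.I := by
    have hI3 : Complex.I ^ 3 = -Complex.I := Complex.I_pow_three
    have hI4 : Complex.I ^ 4 = 1 := Complex.I_pow_four
    push_cast
    linear_combination (6 * s ^ 2 * t ^ 2 : ℂ) * Complex.I_sq + (4 * s * t ^ 3 : ℂ) * hI3 +
      (t ^ 4 : ℂ) * hI4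
  rw [h4'] at h4
  have hre := congrArg Complex.re h4
  have him := congrArg Complex.im h4
  simp only [Complex.add_re, Complex.add_im, Complex.ofReal_re, Complex.ofReal_im,
    Complex.re_ofReal_mul, Complex.im_ofReal_mul, Complex.I_re, Complex.I_im, mul_zero, mul_one,
    add_zero, zero_add] at hre him
  obtain ⟨hMs, hts3⟩ := fourth_power_near_real_axis (by linarith) hN (by linarith) hR hre him hts
  have hs0 : 0 ≤ s := (abs_nonneg _).trans hts
  have hs37 : 10 ^ 37 ≤ s := by
    by_contra! h
    have : s ^ 4 ≤ (10 ^ 37) ^ 4 := by gcongr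
    have : (10 : ℝ) ^ 150 * 1 ≤ M * R := by gcongr; linarith
    norm_num at *
    linarith
  obtain ⟨r, hr⟩ := exists_pow_near_of_large hs37 hts3
  have key : ∀ n, (n = r ∨ n = r + 1) →
      (padeValue n).re * (p.im : ℝ) - (padeValue n).im * (p.re : ℝ) = 0 := by
    intro n hn
    have hu_mem : (239 + Complex.I) ∈ GaussianInt.toComplex.range := ⟨⟨239, 1⟩, by
      simp [GaussianInt.toComplex_def]⟩
    have hv_mem : (239 - Complex.I) ∈ GaussianInt.toComplex.range := ⟨⟨239, -1⟩, by
      simp [GaussianInt.toComplex_def, sub_eq_add_neg]⟩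
    obtain ⟨g, hg⟩ := eight_pow_mul_padeForm_mem hu_mem hv_mem n
    change _ = 8 ^ n * padeValue n at hg
    have hg' : (g : ℂ) = ((8 ^ n : ℝ) : ℂ) * padeValue n := by rw [hg]; push_cast; rfl
    have hgre := congrArg Complex.re hg'
    have hgim := congrArg Complex.im hg'
    rw [Complex.re_ofReal_mul] at hgre
    rw [Complex.im_ofReal_mul] at hgim
    simp only [← GaussianInt.intCast_re, ← GaussianInt.intCast_im] at hgre hgim
    have him_int : ((g.re * p.im - g.im * p.re : ℤ) : ℝ) =
        8 ^ n * ((e * padeValue n).re * t - (e * padeValue n).im * s) := by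
      have hee : e.re ^ 2 + e.im ^ 2 = 1 := by
        have := Complex.sq_norm e
        rw [hen, Complex.normSq_apply] at this
        linarith
      rw [hs, ht]
      push_cast
      rw [hgre, hgim]
      simp only [Complex.mul_re, Complex.mul_im, ← GaussianInt.intCast_re,
        ← GaussianInt.intCast_im]
      linear_combination -(8 ^ n * ((padeValue n).re * p.im - (padeValue n).im * p.re)) * hee
    have hlt : |((g.re * p.im - g.im * p.re : ℤ) : ℝ)| < 1 := by
      have h1 : |(e * padeValue n).re| ≤ 957 ^ n := by
        refine (Complex.abs_re_le_norm _).trans ?_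
        rw [norm_mul, hen, one_mul]
        exact norm_padeValue_le n
      have h2 : 8 ^ n * |(e * padeValue n).im| ≤ (1 / 29) ^ n := by
        rw [hbound n, abs_mul, abs_of_nonneg (by positivity)]
        calc _ ≤ 8 ^ n * (R ^ n * (b ^ (2 * n + 1) / 4)) := by
              gcongr
              exact abs_padeErr_le n hb0
          _ = (8 * (R * b ^ 2)) ^ n * (b / 4) := by ring
          _ ≤ (1 / 29) ^ n * 1 := by
              gcongr
              · linarith
              · linarith
          _ = _ := mul_one _
      have h3 : (1 / 29 : ℝ) ^ n ≤ (1 / 29) ^ r :=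
        pow_le_pow_of_le_one (by norm_num) (by norm_num) (by omega)
      have h5 : (7656 : ℝ) ^ n ≤ 7656 ^ (r + 1) :=
        pow_le_pow_right₀ (by norm_num) (by omega)
      rw [him_int, abs_mul, abs_of_pos (by positivity : (0 : ℝ) < 8 ^ n)]
      calc _ ≤ 8 ^ n * (|(e * padeValue n).re| * |t| + |(e * padeValue n).im| * s) := by
            gcongr
            refine (abs_sub _ _).trans ?_
            rw [abs_mul, abs_mul, abs_of_nonneg hs0]
        _ ≤ 8 ^ n * (957 ^ n * |t| + |(e * padeValue n).im| * s) := by gcongr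
        _ = 7656 ^ n * |t| + 8 ^ n * |(e * padeValue n).im| * s := by
            rw [show (7656 : ℝ) = 8 * 957 by norm_num, mul_pow]
            ring
        _ ≤ 7656 ^ (r + 1) * |t| + (1 / 29) ^ r * s := by
            gcongr
            exact h2.trans h3
        _ < 1 := by linarith
    have h0 : g.re * p.im - g.im * p.re = 0 := Int.abs_lt_one_iff.mp (by exact_mod_cast hlt)
    have h0' : (g.re : ℝ) * p.im - g.im * p.re = 0 := by exact_mod_cast h0
    rw [hgre, hgim] at h0'
    have h8 : (8 : ℝ) ^ n ≠ 0 := by positivity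
    refine (mul_eq_zero.mp ?_).resolve_left h8
    linear_combination h0'
  have k1 := key r (Or.inl rfl)
  have k2 := key (r + 1) (Or.inr rfl)
  have hd := im_conj_padeValue_mul_succ_ne_zero r
  have hre0 : (p.re : ℝ) = 0 := by
    refine (mul_eq_zero.mp ?_).resolve_left hd
    linear_combination (padeValue (r + 1)).re * k1 - (padeValue r).re * k2
  have him0 : (p.im : ℝ) = 0 := by
    refine (mul_eq_zero.mp ?_).resolve_left hd
    linear_combination (padeValue (r + 1)).im * k1 - (padeValue r).im * k2
  have : s = 0 := by
    rw [hs, Complex.mul_re, ← GaussianInt.intCast_re, ← GaussianInt.intCast_im, hre0, him0]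
    ring
  linarith

theorem fourth_power_not_large {p : GaussianInt} {M N : ℝ} (hM : 10 ^ 150 ≤ M)
    (hN : |N| ≤ 2) (hp : (p : ℂ) ^ 4 = (M + N * Complex.I) * (239 + Complex.I)) : False := by
  have hI : GaussianInt.toComplex ⟨0, 1⟩ = Complex.I := by simp [GaussianInt.toComplex_def]
  have hmul : ∀ q : GaussianInt, (((⟨0, 1⟩ * q : GaussianInt)) : ℂ) = Complex.I * q := fun q => by
    rw [map_mul, hI]
  have hrot : ∀ q : GaussianInt, (q : ℂ) ^ 4 = (M + N * Complex.I) * (239 + Complex.I) →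
      (((⟨0, 1⟩ * q : GaussianInt)) : ℂ) ^ 4 = (M + N * Complex.I) * (239 + Complex.I) := by
    intro q hq
    rw [hmul, mul_pow, Complex.I_pow_four, one_mul, hq]
  have a0 := fun h => fourth_power_not_large_of_le hM hN hp h
  have a1 := fun h => fourth_power_not_large_of_le hM hN (hrot _ hp) h
  have a2 := fun h => fourth_power_not_large_of_le hM hN (hrot _ (hrot _ hp)) h
  have a3 := fun h => fourth_power_not_large_of_le hM hN (hrot _ (hrot _ (hrot _ hp))) h
  simp only [hmul, mul_left_comm _ Complex.I, Complex.I_mul_re, Complex.I_mul_im, abs_neg]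
    at a0 a1 a2 a3
  generalize (Complex.exp (-((239 + Complex.I).arg / 4 : ℝ) * Complex.I) * p).re = x at *
  generalize (Complex.exp (-((239 + Complex.I).arg / 4 : ℝ) * Complex.I) * p).im = y at *
  rcases abs_cases x with ⟨hx, _⟩ | ⟨hx, _⟩ <;> rcases abs_cases y with ⟨hy, _⟩ | ⟨hy, _⟩ <;>
    rw [hx] at a1 a3 <;> rw [hy] at a0 a2 <;> rcases le_total |x| |y| with h | h <;>
    rw [hx, hy] at h <;>
    first
    | exact a0 (by linarith)
    | exact a1 (by linarith)
    | exact a2 (by linarith)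
    | exact a3 (by linarith)

end Pade

theorem sq_add_sq_lt_of_quartic_eq_one {p q : ℤ}
    (h : p ^ 4 + 4 * p ^ 3 * q - 6 * p ^ 2 * q ^ 2 - 4 * p * q ^ 3 + q ^ 4 = 1) :
    p ^ 2 + q ^ 2 < 10 ^ 80 := by
  by_contra! hlarge
  obtain ⟨w, hw⟩ : ∃ w, w = 4 * p ^ 3 * q - 4 * p * q ^ 3 - (p ^ 4 - 6 * p ^ 2 * q ^ 2 + q ^ 4) :=
    ⟨_, rfl⟩
  have hnorm : 1 + w ^ 2 = 2 * (p ^ 2 + q ^ 2) ^ 4 := by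
    have h1 : (1 : ℤ) = (p ^ 4 + 4 * p ^ 3 * q - 6 * p ^ 2 * q ^ 2 - 4 * p * q ^ 3 + q ^ 4) ^ 2 := by
      rw [h]; norm_num
    rw [hw]; nth_rw 1 [h1]; ring
  have hw_large : (10 : ℤ) ^ 160 ≤ |w| := by
    apply abs_le_of_sq_le_sq' _ (abs_nonneg w) |>.2
    rw [sq_abs]
    have h4 : ((10 : ℤ) ^ 80) ^ 4 ≤ (p ^ 2 + q ^ 2) ^ 4 := by gcongr
    norm_num at h4 ⊢
    linarith
  have hρ : (((⟨3 * p + 2 * q, 3 * q - 2 * p⟩ : GaussianInt) : ℂ)) ^ 4 =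
      (w - Complex.I) * (239 + Complex.I) / 2 := by
    have hc : (p ^ 4 + 4 * p ^ 3 * q - 6 * p ^ 2 * q ^ 2 - 4 * p * q ^ 3 + q ^ 4 : ℂ) = 1 := by
      exact_mod_cast congrArg (Int.cast : ℤ → ℂ) h
    have hwc : (w : ℂ) =
        4 * p ^ 3 * q - 4 * p * q ^ 3 - (p ^ 4 - 6 * p ^ 2 * q ^ 2 + q ^ 4) := by
      rw [hw]; push_cast; ring
    have hI := Complex.I_sq
    have hI3 : Complex.I ^ 3 = -Complex.I := Complex.I_pow_three
    have hI4 : Complex.I ^ 4 = 1 := Complex.I_pow_four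
    rw [GaussianInt.toComplex_def]
    push_cast
    rw [hwc, eq_div_iff two_ne_zero]
    have e : (4 * p ^ 3 * q - 4 * p * q ^ 3 - (p ^ 4 - 6 * p ^ 2 * q ^ 2 + q ^ 4) - Complex.I : ℂ) =
      (4 * p ^ 3 * q - 4 * p * q ^ 3 - (p ^ 4 - 6 * p ^ 2 * q ^ 2 + q ^ 4) -
        (p ^ 4 + 4 * p ^ 3 * q - 6 * p ^ 2 * q ^ 2 - 4 * p * q ^ 3 + q ^ 4) * Complex.I) := by
      rw [hc, one_mul]
    rw [e]
    ring_nf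
    rw [hI, hI3, hI4]
    ring
  rcases le_total 0 w with hpos | hneg
  · rw [abs_of_nonneg hpos] at hw_large
    have hwR : (10 : ℝ) ^ 160 ≤ w := by exact_mod_cast hw_large
    refine fourth_power_not_large (M := w / 2) (N := -1 / 2) ?_ ?_ (hρ.trans ?_)
    · norm_num at hwR ⊢; linarith
    · norm_num [abs_le]
    · push_cast; ring
  · rw [abs_of_nonpos hneg] at hw_large
    have hwR : (10 : ℝ) ^ 160 ≤ -w := by exact_mod_cast hw_large
    refine fourth_power_not_large (p := ⟨1, 1⟩ * ⟨3 * p + 2 * q, 3 * q - 2 * p⟩)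
      (M := -2 * w) (N := 2) ?_ ?_ ?_
    · norm_num at hwR ⊢; linarith
    · norm_num [abs_le]
    · rw [GaussianInt.toComplex_mul, mul_pow, hρ]
      have h1 : (((⟨1, 1⟩ : GaussianInt) : ℂ)) ^ 4 = -4 := by
        have hI := Complex.I_sq
        have hI3 : Complex.I ^ 3 = -Complex.I := Complex.I_pow_three
        have hI4 : Complex.I ^ 4 = 1 := Complex.I_pow_four
        rw [GaussianInt.toComplex_def]
        push_cast
        ring_nf
        rw [hI, hI3, hI4]
        ring
      rw [h1]; push_cast; ring

theorem pell_two_mul_add (m : ℕ) :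
    pell (2 * m + 1) = pell m ^ 2 + pell (m + 1) ^ 2 ∧
      pell (2 * m + 2) = 2 * pell (m + 1) * (pell m + pell (m + 1)) := by
  induction m with
  | zero => simp [pell]
  | succ m ih =>
    have h1 : pell (2 * (m + 1) + 1) = 2 * pell (2 * m + 2) + pell (2 * m + 1) := by
      rw [show 2 * (m + 1) + 1 = 2 * m + 1 + 2 by ring, pell]
    have h2 : pell (2 * (m + 1) + 2) = 2 * pell (2 * (m + 1) + 1) + pell (2 * m + 2) := by
      rw [show 2 * (m + 1) + 2 = 2 * m + 2 + 2 by ring, pell]; rfl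
    have h3 : pell (m + 1 + 1) = 2 * pell (m + 1) + pell m := by rw [pell]
    rw [h2, h1, ih.1, ih.2, h3]
    constructor <;> ring

theorem pell_cassini (m : ℕ) :
    pell (m + 1) ^ 2 - 2 * pell m * pell (m + 1) - pell m ^ 2 = (-1) ^ m := by
  induction m with
  | zero => simp [pell]
  | succ m ih =>
    rw [pow_succ (-1 : ℤ), ← ih, show pell (m + 1 + 1) = 2 * pell (m + 1) + pell m by rw [pell]]
    ring

theorem pell_nonneg_and_pos (m : ℕ) : 0 ≤ pell m ∧ 0 < pell (m + 1) := by
  induction m with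
  | zero => simp [pell]
  | succ m ih =>
    have h3 : pell (m + 1 + 1) = 2 * pell (m + 1) + pell m := by rw [pell]
    constructor <;> omega

theorem pell_monotone : Monotone pell := by
  refine monotone_nat_of_le_succ fun m => ?_
  cases m with
  | zero => simp [pell]
  | succ m =>
    have h3 : pell (m + 1 + 1) = 2 * pell (m + 1) + pell m := by rw [pell]
    have := pell_nonneg_and_pos m
    omega

theorem pell_mod_two (m : ℕ) : pell m % 2 = m % 2 := by
  induction m using Nat.twoStepInduction with
  | zero => simp [pell]
  | one => simp [pell]
  | more m h1 h2 => rw [pell]; omega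

theorem pell_gcd_succ (m : ℕ) : Int.gcd (pell m) (pell (m + 1)) = 1 := by
  rw [← Int.isCoprime_iff_gcd_eq_one]
  have h := pell_cassini m
  rcases neg_one_pow_eq_or ℤ m with h1 | h1 <;> rw [h1] at h
  · exact ⟨-2 * pell (m + 1) - pell m, pell (m + 1), by linear_combination h⟩
  · exact ⟨2 * pell (m + 1) + pell m, -pell (m + 1), by linear_combination -h⟩

theorem pell_isSquare_small : ∀ ℓ < 500, IsSquare (pell ℓ) → ℓ = 0 ∨ ℓ = 1 ∨ ℓ = 7 := by
  decide +kernel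

theorem sq_lt_of_pell_odd_eq_sq {m : ℕ} {y : ℤ} (h : pell (2 * m + 1) = y ^ 2) :
    pell (2 * m + 1) < 10 ^ 160 := by
  have hpyth : PythagoreanTriple (pell m) (pell (m + 1)) y := by
    have := (pell_two_mul_add m).1
    unfold PythagoreanTriple
    linarith
  obtain ⟨p, q, hxy, hy, -, -⟩ := PythagoreanTriple.coprime_classification.mp
    ⟨hpyth, pell_gcd_succ m⟩
  have hpar1 := pell_mod_two m
  have hpar2 := pell_mod_two (m + 1)
  have hc := pell_cassini m
  have hlt : p ^ 2 + q ^ 2 < 10 ^ 80 := by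
    rcases hxy with ⟨hx, hx'⟩ | ⟨hx, hx'⟩
    · have hm : Odd m := by
        rw [Nat.odd_iff]
        rw [hx', mul_assoc, Int.mul_emod_right] at hpar2
        omega
      rw [hm.neg_one_pow, hx, hx'] at hc
      exact sq_add_sq_lt_of_quartic_eq_one (p := p) (q := q) (by linear_combination -hc)
    · have hm : Even m := by
        rw [Nat.even_iff]
        rw [hx, mul_assoc, Int.mul_emod_right] at hpar1
        omega
      rw [hm.neg_one_pow, hx, hx'] at hc
      have := sq_add_sq_lt_of_quartic_eq_one (p := p) (q := -q) (by linear_combination hc)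
      rwa [neg_sq] at this
  have hy2 : y ^ 2 = (p ^ 2 + q ^ 2) ^ 2 := by rcases hy with rfl | rfl <;> ring
  rw [h, hy2]
  calc (p ^ 2 + q ^ 2) ^ 2 < (10 ^ 80) ^ 2 := by
        exact pow_lt_pow_left₀ hlt (by positivity) two_ne_zero
    _ = 10 ^ 160 := by norm_num

theorem eq_zero_of_mul_succ_mul_eq_pow_four {k d : ℕ}
    (h : k * (k + 1) * (2 * (k * (k + 1)) + 1) = d ^ 4) : k = 0 := by
  have hcop : Nat.Coprime (k * (k + 1)) (2 * (k * (k + 1)) + 1) := by simp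
  obtain ⟨e, he⟩ := exists_eq_pow_of_mul_eq_pow (Nat.isUnit_iff.mpr hcop) h
  have h1 : k < e ^ 2 ∨ e ^ 2 ≤ k := lt_or_ge _ _
  rcases h1 with h1 | h1 <;> nlinarith [sq_nonneg e]

theorem eq_zero_of_sq_eq_two_mul_pow_four_add_one {x y : ℕ} (h : x ^ 2 = 2 * y ^ 4 + 1) :
    y = 0 := by
  obtain ⟨a, rfl⟩ : Odd x := by
    rw [← Nat.odd_pow_iff two_ne_zero, h]; exact ⟨_, rfl⟩
  have h1 : 2 * (a * (a + 1)) = y ^ 4 := by nlinarith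
  obtain ⟨z, rfl⟩ : 2 ∣ y := Nat.prime_two.dvd_of_dvd_pow ⟨_, h1.symm⟩
  have h2 : a * (a + 1) = 8 * z ^ 4 := by nlinarith
  rcases Nat.even_or_odd' a with ⟨b, rfl | rfl⟩
  · have hb : 4 ∣ b := by
      have h3 : b * (2 * b + 1) = 4 * z ^ 4 := by nlinarith
      have : Nat.Coprime 4 (2 * b + 1) := by
        rw [show 4 = 2 ^ 2 by rfl]
        exact Nat.Coprime.pow_left _ (by simp)
      exact this.dvd_of_dvd_mul_right ⟨_, h3⟩
    obtain ⟨s, rfl⟩ := hb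
    have h3 : (2 * (4 * s) + 1) * s = z ^ 4 := by nlinarith
    have hcop' : Nat.Coprime (2 * (4 * s) + 1) s := by
      rw [show 2 * (4 * s) + 1 = 1 + s * 8 by ring]; simp
    obtain ⟨c, hc⟩ := exists_eq_pow_of_mul_eq_pow (Nat.isUnit_iff.mpr hcop') h3
    obtain ⟨d, hd⟩ := exists_eq_pow_of_mul_eq_pow (Nat.isUnit_iff.mpr hcop'.symm)
      ((mul_comm _ _).trans h3)
    obtain ⟨k, rfl⟩ : Odd c := by
      rw [← Nat.odd_pow_iff four_ne_zero, ← hc]; exact ⟨_, rfl⟩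
    have hk : k = 0 := eq_zero_of_mul_succ_mul_eq_pow_four (d := d) (by rw [← hd]; nlinarith)
    subst hk
    have hs : s = 0 := by simp at hc; exact hc
    subst hs
    simpa using h3.symm
  · exfalso
    obtain ⟨s, hs⟩ : 4 ∣ b + 1 := by
      have h3 : (b + 1) * (2 * b + 1) = 4 * z ^ 4 := by nlinarith
      have : Nat.Coprime 4 (2 * b + 1) := by
        rw [show 4 = 2 ^ 2 by rfl]
        exact Nat.Coprime.pow_left _ (by simp)
      exact this.dvd_of_dvd_mul_right ⟨_, h3⟩
    have h3 : (2 * b + 1) * s = z ^ 4 := by nlinarith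
    have hcop' : Nat.Coprime (2 * b + 1) s := by
      refine Nat.Coprime.coprime_dvd_right (m := 2 * b + 1 + 1) ⟨8, by omega⟩ (by simp)
    obtain ⟨c, hc⟩ := exists_eq_pow_of_mul_eq_pow (Nat.isUnit_iff.mpr hcop') h3
    obtain ⟨k, rfl⟩ : Odd c := by
      rw [← Nat.odd_pow_iff four_ne_zero, ← hc]; exact ⟨_, rfl⟩
    have : (2 * k + 1) ^ 4 = 8 * (2 * k ^ 4 + 4 * k ^ 3 + 3 * k ^ 2 + k) + 1 := by ring
    omega

theorem pell_eq_sq {ℓ : ℕ} (hℓ : 0 < ℓ) {y : ℤ} (h : y ^ 2 = pell ℓ) : ℓ = 1 ∨ ℓ = 7 := by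
  rcases Nat.even_or_odd' ℓ with ⟨m, rfl | rfl⟩
  · exfalso
    obtain ⟨n, rfl⟩ : ∃ n, m = n + 1 := ⟨m - 1, by omega⟩
    have hc := pell_cassini (2 * (n + 1))
    rw [pow_mul, neg_one_sq, one_pow] at hc
    have hx : (pell (2 * (n + 1) + 1) - pell (2 * (n + 1))) ^ 2 = 2 * y ^ 4 + 1 := by
      rw [show y ^ 4 = (y ^ 2) ^ 2 by ring, h]
      linear_combination hc
    have hy : y.natAbs = 0 := by
      apply eq_zero_of_sq_eq_two_mul_pow_four_add_one
        (x := (pell (2 * (n + 1) + 1) - pell (2 * (n + 1))).natAbs)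
      zify
      rw [sq_abs, hx, show |y| ^ 4 = (|y| ^ 2) ^ 2 by ring, sq_abs]
      ring
    have hpos := (pell_nonneg_and_pos (2 * n + 1)).2
    rw [Int.natAbs_eq_zero.mp hy] at h
    rw [show 2 * (n + 1) = 2 * n + 1 + 1 by ring] at h
    omega
  · have hlt := sq_lt_of_pell_odd_eq_sq h.symm
    have hsmall : 2 * m + 1 < 500 := by
      by_contra! hge
      have h1 := pell_monotone hge
      have h2 : (10 : ℤ) ^ 160 ≤ pell 500 := by decide +kernel
      exact absurd (h2.trans h1) (not_le.mpr hlt)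
    have := pell_isSquare_small _ hsmall ⟨y, by rw [← h, sq]⟩
    omega

theorem kfib_of_lt {k j : ℕ} (hk : 2 ≤ k) (hj : j + 1 < k) : kfib k j = 0 := by
  rw [kfib, if_neg (by omega), if_pos (by omega)]

theorem kfib_sub_one {k : ℕ} (hk : 2 ≤ k) : kfib k (k - 1) = 1 := by
  rw [kfib, if_neg (by omega), if_neg (by omega), if_pos rfl]

theorem kfib_add {k : ℕ} (hk : 2 ≤ k) (i : ℕ) :
    kfib k (i + k) = ∑ s ∈ Finset.range k, kfib k (i + s) := by
  rw [kfib, if_neg (by omega), if_neg (by omega), if_neg (by omega), ← Finset.sum_range_reflect]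
  refine Finset.sum_congr rfl fun s hs => ?_
  rw [Finset.mem_range] at hs
  congr 1
  omega

theorem kfib_self {k : ℕ} (hk : 2 ≤ k) : kfib k k = 1 := by
  obtain ⟨c, rfl⟩ : ∃ c, k = c + 1 := ⟨k - 1, by omega⟩
  have h := kfib_add hk 0
  rw [zero_add, Finset.sum_range_succ, Finset.sum_eq_zero] at h
  · simpa using h.trans (by simpa using kfib_sub_one hk)
  · intro s hs
    rw [Finset.mem_range] at hs
    exact kfib_of_lt hk (by omega)

theorem kfib_succ {k : ℕ} (hk : 2 ≤ k) (i : ℕ) :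
    kfib k (i + 1 + k) = 2 * kfib k (i + k) - kfib k i := by
  have h1 := kfib_add hk (i + 1)
  have h2 := Finset.sum_range_succ (fun s => kfib k (i + s)) k
  rw [Finset.sum_range_succ', ← kfib_add hk i] at h2
  simp only [add_zero] at h2
  have h3 : ∑ s ∈ Finset.range k, kfib k (i + 1 + s) =
      ∑ s ∈ Finset.range k, kfib k (i + (s + 1)) :=
    Finset.sum_congr rfl fun s _ => by congr 1; ring
  rw [h3] at h1
  linarith

theorem kfib_nonneg {k : ℕ} (hk : 2 ≤ k) (j : ℕ) : 0 ≤ kfib k j := by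
  induction j using Nat.strong_induction_on with
  | _ j ih =>
    rcases lt_or_ge j k with h | h
    · rcases (by omega : j + 1 < k ∨ j = k - 1) with h1 | rfl
      · rw [kfib_of_lt hk h1]
      · rw [kfib_sub_one hk]; norm_num
    · obtain ⟨i, rfl⟩ : ∃ i, j = i + k := ⟨j - k, by omega⟩
      rw [kfib_add hk]
      refine Finset.sum_nonneg fun s hs => ih _ ?_
      rw [Finset.mem_range] at hs
      omega

theorem kfib_add_two_le {k : ℕ} (hk : 3 ≤ k) (i : ℕ) :
    kfib k (i + k) + kfib k (i + k - 1) ≤ kfib k (i + 1 + k) := by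
  rw [kfib_add (by omega) (i + 1)]
  have hsub : ({k - 2, k - 1} : Finset ℕ) ⊆ Finset.range k := by
    intro s hs
    simp only [Finset.mem_insert, Finset.mem_singleton] at hs
    rw [Finset.mem_range]
    omega
  have h := Finset.sum_le_sum_of_subset_of_nonneg (f := fun s => kfib k (i + 1 + s)) hsub
    fun s _ _ => kfib_nonneg (by omega) _
  rw [Finset.sum_pair (by omega)] at h
  rw [show i + 1 + (k - 2) = i + k - 1 by omega, show i + 1 + (k - 1) = i + k by omega] at h
  linarith

theorem kfib_pos {k : ℕ} (hk : 3 ≤ k) (i : ℕ) : 0 < kfib k (i + k - 1) ∧ 0 < kfib k (i + k) := by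
  induction i with
  | zero =>
    rw [zero_add, kfib_sub_one (by omega), kfib_self (by omega)]
    norm_num
  | succ i ih =>
    have h := kfib_add_two_le hk i
    rw [show i + 1 + k - 1 = i + k by omega]
    exact ⟨ih.2, by linarith [ih.1, ih.2]⟩

theorem kfib_strictMono {k : ℕ} (hk : 3 ≤ k) : StrictMono fun i => kfib k (i + k) :=
  strictMono_nat_of_lt_succ fun i => by
    linarith [kfib_add_two_le hk i, (kfib_pos hk i).1]

theorem kfib_eq_two_pow {k i : ℕ} (hk : 2 ≤ k) (hi : i < k) : kfib k (i + k) = 2 ^ i := by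
  induction i with
  | zero => rw [zero_add, kfib_self hk, pow_zero]
  | succ i ih =>
    rw [kfib_succ hk, ih (by omega), kfib_of_lt hk hi, pow_succ]
    ring

theorem kfib_three_values : kfib 3 (3 + 3) = 7 ∧ kfib 3 (4 + 3) = 13 := by
  have h2 := kfib_eq_two_pow (k := 3) (i := 2) (by norm_num) (by norm_num)
  have h3 := kfib_succ (k := 3) (by norm_num) 2
  have h4 := kfib_succ (k := 3) (by norm_num) 3
  have h5 := kfib_sub_one (k := 3) (by norm_num)
  have h6 := kfib_self (k := 3) (by norm_num)
  norm_num at h2 h3 h4 h5 h6 ⊢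
  constructor <;> linarith

theorem kfib_eq_thirteen {k i : ℕ} (hk : 3 ≤ k) (h : kfib k (i + k) = 13) : i = 4 ∧ k = 3 := by
  have hmono := kfib_strictMono hk
  rcases hk.eq_or_lt with rfl | hk4
  · exact ⟨hmono.injective (h.trans kfib_three_values.2.symm), rfl⟩
  · exfalso
    have h3 := kfib_eq_two_pow (k := k) (i := 3) (by omega) hk4
    have h4 : 13 < kfib k (4 + k) := by
      rw [kfib_succ (by omega) 3, h3]
      rcases (Nat.succ_le_of_lt hk4).eq_or_lt with rfl | hk5
      · have := kfib_sub_one (k := 4) (by norm_num)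
        norm_num at this ⊢
        omega
      · rw [kfib_of_lt (by omega) (by omega)]
        norm_num
    have hlt : i < 4 := hmono.lt_iff_lt.mp (by simpa only [h] using h4)
    have hgt : 3 < i := hmono.lt_iff_lt.mp (by simp only [h, h3]; norm_num)
    omega

/-- The only positive integers `n, k, ℓ` with `k ≥ 3` and `n ≥ 3` satisfying
`(F⁽ᵏ⁾_n)² = P_ℓ` are `(n, k, ℓ) = (6, 3, 7)`, i.e. `13² = 169 = P₇`. -/
theorem kfib_sq_eq_pell (n k ℓ : ℕ) (hk : 3 ≤ k) (hn : 3 ≤ n) (hℓ : 0 < ℓ) :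
    (kfib k (n + k - 2)) ^ 2 = pell ℓ ↔ (n, k, ℓ) = (6, 3, 7) := by
  constructor
  · intro h
    obtain ⟨i, rfl⟩ : ∃ i, n = i + 2 := ⟨n - 2, by omega⟩
    rw [show i + 2 + k - 2 = i + k by omega] at h
    have hpos : 1 < kfib k (i + k) := by
      have := kfib_strictMono hk (show 0 < i by omega)
      simpa only [zero_add, kfib_self (show 2 ≤ k by omega)] using this
    rcases pell_eq_sq hℓ h with rfl | rfl
    · rw [show pell 1 = 1 from rfl] at h
      nlinarith
    · rw [show pell 7 = 13 ^ 2 by decide +kernel] at h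
      have h13 : kfib k (i + k) = 13 :=
        (pow_left_inj₀ (by omega) (by norm_num) two_ne_zero).mp h
      obtain ⟨rfl, rfl⟩ := kfib_eq_thirteen hk h13
      rfl
  · intro h
    simp only [Prod.mk.injEq] at h
    obtain ⟨rfl, rfl, rfl⟩ := h
    rw [show 6 + 3 - 2 = 4 + 3 by norm_num, kfib_three_values.2]
    decide +kernel
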